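/- arXiv:1207.1630 — 4 statements merged into one kernel-verified Lean document; each statement's English description precedes it below -/
import Mathlib

section
/- For every k ∈ ℝ and every complex number λ with Im λ < −1, the function y ↦ e^{−iλy}·max(e^y − e^k, 0) is integrable on ℝ and ∫_ℝ e^{−iλy} max(e^y − e^k, 0) dy = −e^{k − ikλ}/(iλ + λ²). -/
open MeasureTheory

/-- The call payoff multiplied by `e^{ay}` is a difference of exponentials cut off at the
log-strike. -/
theorem exp_mul_call_payoff_eq_indicator (a : ℂ) (k : ℝ) :
    (fun y : ℝ => Complex.exp (a * y) * ((max (Real.exp y - Real.exp k) 0 : ℝ) : ℂ)) =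
      (Set.Ioi k).indicator
        (fun y : ℝ => Complex.exp ((a + 1) * y) - Complex.exp k * Complex.exp (a * y)) := by
  ext y
  by_cases hy : k < y
  · rw [Set.indicator_of_mem (Set.mem_Ioi.2 hy),
      max_eq_left (sub_nonneg.2 (Real.exp_le_exp.2 hy.le)), add_mul, one_mul, Complex.exp_add]
    push_cast
    ring
  · rw [Set.indicator_of_notMem (by simpa using hy),
      max_eq_right (sub_nonpos.2 (Real.exp_le_exp.2 (not_lt.1 hy)))]
    simp

/-- The call payoff is integrable against `e^{ay}` when `Re a < -1`. -/
theorem integrable_exp_mul_call_payoff {a : ℂ} (ha : a.re < -1) (k : ℝ) :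
    Integrable
      (fun y : ℝ => Complex.exp (a * y) * ((max (Real.exp y - Real.exp k) 0 : ℝ) : ℂ)) := by
  rw [exp_mul_call_payoff_eq_indicator, integrable_indicator_iff measurableSet_Ioi]
  exact (integrableOn_exp_mul_complex_Ioi
    (by rw [Complex.add_re, Complex.one_re]; linarith) k).sub
      ((integrableOn_exp_mul_complex_Ioi (by linarith) k).const_mul _)

/-- The two-sided Laplace transform of the call payoff. -/
theorem integral_exp_mul_call_payoff {a : ℂ} (ha : a.re < -1) (k : ℝ) :
    ∫ y : ℝ, Complex.exp (a * y) * ((max (Real.exp y - Real.exp k) 0 : ℝ) : ℂ) =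
      Complex.exp (k + a * k) / (a * (a + 1)) := by
  have ha₀ : a.re < 0 := by linarith
  have ha₁ : (a + 1).re < 0 := by rw [Complex.add_re, Complex.one_re]; linarith
  have hne₀ : a ≠ 0 := by rintro rfl; simp at ha₀
  have hne₁ : a + 1 ≠ 0 := by intro h; simp [h] at ha₁
  rw [exp_mul_call_payoff_eq_indicator, integral_indicator measurableSet_Ioi,
    integral_sub (integrableOn_exp_mul_complex_Ioi ha₁ k)
      ((integrableOn_exp_mul_complex_Ioi ha₀ k).const_mul _),
    integral_const_mul, integral_exp_mul_complex_Ioi ha₁, integral_exp_mul_complex_Ioi ha₀,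
    add_mul, one_mul, Complex.exp_add, Complex.exp_add]
  field_simp
  ring

/-- The generalized Fourier transform of the call payoff `y ↦ (e^y − e^k)⁺`:
for every real log-strike `k` and every complex `λ` with `Im λ < −1`, the function
`y ↦ e^{−iλy} · max(e^y − e^k, 0)` is Lebesgue-integrable on `ℝ` and its integral
equals `−e^{k − ikλ}/(iλ + λ²)`. -/
theorem call_payoff_generalized_fourier (k : ℝ) (lam : ℂ) (hlam : lam.im < -1) :
    Integrable
      (fun y : ℝ =>
        Complex.exp (-Complex.I * lam * (y : ℂ)) *
          ((max (Real.exp y - Real.exp k) 0 : ℝ) : ℂ)) volume ∧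
    (∫ y : ℝ,
        Complex.exp (-Complex.I * lam * (y : ℂ)) *
          ((max (Real.exp y - Real.exp k) 0 : ℝ) : ℂ)) =
      -Complex.exp ((k : ℂ) - Complex.I * (k : ℂ) * lam) /
        (Complex.I * lam + lam ^ 2) := by
  have ha : (-Complex.I * lam).re < -1 := by simpa using hlam
  refine ⟨integrable_exp_mul_call_payoff ha k, ?_⟩
  rw [integral_exp_mul_call_payoff ha, neg_div, ← div_neg]
  congr 1
  · congr 1
    ring
  · linear_combination lam ^ 2 * Complex.I_sq
end

section
/- Fix t > 0 and y, k ∈ ℝ. Let Φ(x) = ∫_{−∞}^x e^{−u²/2}/√(2π) du denote the standard normal cumulative distribution function, and for σ > 0 set d₊(σ) = (y − k + σ²t/2)/(σ√t), d₋(σ) = d₊(σ) − σ√t, and C(σ) = e^y Φ(d₊(σ)) − e^k Φ(d₋(σ)). Then C is strictly increasing on (0, ∞). -/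
open MeasureTheory

/-- The standard normal cumulative distribution function. -/
noncomputable def stdNormalCdf (x : ℝ) : ℝ :=
  ∫ u in Set.Iio x, Real.exp (-u ^ 2 / 2) / Real.sqrt (2 * Real.pi)

/-- `d₊` in the Black–Scholes formula (zero rates), as a function of volatility. -/
noncomputable def dPlus (t y k σ : ℝ) : ℝ :=
  (y - k + σ ^ 2 * t / 2) / (σ * Real.sqrt t)

/-- `d₋` in the Black–Scholes formula (zero rates), as a function of volatility. -/
noncomputable def dMinus (t y k σ : ℝ) : ℝ :=
  dPlus t y k σ - σ * Real.sqrt t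

/-- The Black–Scholes call price (zero rates) with time to maturity `t`, log-spot `y`
and log-strike `k`, as a function of the volatility `σ`. -/
noncomputable def bsCall (t y k σ : ℝ) : ℝ :=
  Real.exp y * stdNormalCdf (dPlus t y k σ) - Real.exp k * stdNormalCdf (dMinus t y k σ)


/-- The standard normal density is integrable. -/
theorem integrable_stdNormalDensity :
    Integrable fun u : ℝ => Real.exp (-u ^ 2 / 2) / Real.sqrt (2 * Real.pi) := by
  have h := (integrable_exp_neg_mul_sq (b := 1 / 2) (by norm_num)).div_const
    (Real.sqrt (2 * Real.pi))
  refine h.congr (Filter.Eventually.of_forall fun u => ?_)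
  ring_nf

/-- The derivative of the standard normal distribution function is its density. -/
theorem hasDerivAt_stdNormalCdf (x : ℝ) :
    HasDerivAt stdNormalCdf (Real.exp (-x ^ 2 / 2) / Real.sqrt (2 * Real.pi)) x := by
  have hint := integrable_stdNormalDensity
  have hcont : Continuous fun u : ℝ => Real.exp (-u ^ 2 / 2) / Real.sqrt (2 * Real.pi) := by
    fun_prop
  have hcdf : stdNormalCdf = fun z => stdNormalCdf 0 +
      ∫ u in (0 : ℝ)..z, Real.exp (-u ^ 2 / 2) / Real.sqrt (2 * Real.pi) := by
    funext z
    rw [← intervalIntegral.integral_Iic_sub_Iic hint.integrableOn hint.integrableOn]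
    simp only [stdNormalCdf, integral_Iic_eq_integral_Iio]
    ring
  rw [hcdf]
  exact (intervalIntegral.integral_hasDerivAt_right hint.intervalIntegrable
    (hcont.stronglyMeasurableAtFilter _ _) hcont.continuousAt).const_add _

/-- The discounted densities at `d₊` and `d₋` agree. -/
theorem exp_mul_exp_dPlus_eq {t σ : ℝ} (y k : ℝ) (ht : 0 < t) (hσ : 0 < σ) :
    Real.exp y * Real.exp (-dPlus t y k σ ^ 2 / 2) =
      Real.exp k * Real.exp (-dMinus t y k σ ^ 2 / 2) := by
  have hs : 0 < Real.sqrt t := Real.sqrt_pos.2 ht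
  have hd : dPlus t y k σ * (σ * Real.sqrt t) = y - k + σ ^ 2 * t / 2 :=
    div_mul_cancel₀ _ (mul_pos hσ hs).ne'
  rw [← Real.exp_add, ← Real.exp_add, dMinus]
  congr 1
  linear_combination (-1 : ℝ) * hd + σ ^ 2 / 2 * Real.sq_sqrt ht.le

/-- The vega of the call option: the derivative of its price in the volatility. -/
theorem hasDerivAt_bsCall {t σ : ℝ} (y k : ℝ) (ht : 0 < t) (hσ : 0 < σ) :
    HasDerivAt (bsCall t y k)
      (Real.exp y * (Real.exp (-dPlus t y k σ ^ 2 / 2) / Real.sqrt (2 * Real.pi)) *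
        Real.sqrt t) σ := by
  have hs : 0 < Real.sqrt t := Real.sqrt_pos.2 ht
  have hp : HasDerivAt (dPlus t y k) (deriv (dPlus t y k) σ) σ := by
    refine DifferentiableAt.hasDerivAt ?_
    exact DifferentiableAt.div (by fun_prop) (by fun_prop) (mul_pos hσ hs).ne'
  have hm : HasDerivAt (dMinus t y k) (deriv (dPlus t y k) σ - 1 * Real.sqrt t) σ :=
    hp.sub ((hasDerivAt_id σ).mul_const _)
  refine ((((hasDerivAt_stdNormalCdf _).comp σ hp).const_mul (Real.exp y)).sub
    (((hasDerivAt_stdNormalCdf _).comp σ hm).const_mul (Real.exp k))).congr_deriv ?_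
  linear_combination (deriv (dPlus t y k) σ - Real.sqrt t) / Real.sqrt (2 * Real.pi) *
    exp_mul_exp_dPlus_eq y k ht hσ

/-- The Black–Scholes call price is strictly increasing in the volatility on `(0,∞)`. -/
theorem bsCall_strictMonoOn (t y k : ℝ) (ht : 0 < t) :
    StrictMonoOn (fun σ => bsCall t y k σ) (Set.Ioi (0 : ℝ)) := by
  refine strictMonoOn_of_deriv_pos (convex_Ioi 0) (fun σ hσ =>
    (hasDerivAt_bsCall y k ht hσ).continuousAt.continuousWithinAt) fun σ hσ => ?_
  rw [interior_Ioi] at hσ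
  rw [(hasDerivAt_bsCall y k ht hσ).deriv]
  have hs : 0 < Real.sqrt t := Real.sqrt_pos.2 ht
  positivity
end

section
/- Let f : ℝ → ℝ be real analytic on a neighborhood of a point σ₀ with f′(σ₀) ≠ 0. For each n ≥ 1 suppose the limit b_n = lim_{σ → σ₀} (d^{n−1}/dσ^{n−1}) [ ((σ − σ₀)/(f(σ) − f(σ₀)))^n ] exists. Then there exists R > 0 such that for every u with |u − f(σ₀)| < R, the series σ₀ + Σ_{n=1}^{∞} (b_n / n!) (u − f(σ₀))^n converges, and its sum σ satisfies f(σ) = u; moreover the map u ↦ σ defined by this series is real analytic on the interval (f(σ₀) − R, f(σ₀) + R). -/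
open Filter Topology

section LagrangeCoefficients

variable {𝕜 : Type*} [NontriviallyNormedField 𝕜] {f : 𝕜 → 𝕜} {a : 𝕜}

theorem AnalyticAt.dslope_same (hf : AnalyticAt 𝕜 f a) : AnalyticAt 𝕜 (dslope f a) a := by
  obtain ⟨p, hp⟩ := hf
  exact hp.has_fpower_series_dslope_fslope.analyticAt

variable [CompleteSpace 𝕜]

theorem iteratedDeriv_succ_sub_mul {ψ : 𝕜 → 𝕜} (hψ : AnalyticAt 𝕜 ψ a) (n : ℕ) :
    iteratedDeriv (n + 1) (fun s => (s - a) * ψ s) a = (n + 1) * iteratedDeriv n ψ a := by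
  induction n generalizing ψ with
  | zero =>
    have h : HasDerivAt (fun s => (s - a) * ψ s) (1 * ψ a + (a - a) * deriv ψ a) a :=
      ((hasDerivAt_id a).sub_const a).mul hψ.differentiableAt.hasDerivAt
    simpa [iteratedDeriv_one] using h.deriv
  | succ n ih =>
    have h : deriv (fun s => (s - a) * ψ s) =ᶠ[𝓝 a] ψ + fun s => (s - a) * deriv ψ s := by
      filter_upwards [hψ.eventually_analyticAt] with s hs
      have h : HasDerivAt (fun s => (s - a) * ψ s) (1 * ψ s + (s - a) * deriv ψ s) s :=
        ((hasDerivAt_id s).sub_const a).mul hs.differentiableAt.hasDerivAt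
      simpa using h.deriv
    have hd : AnalyticAt 𝕜 (fun s => (s - a) * deriv ψ s) a :=
      (analyticAt_id.sub analyticAt_const).mul hψ.deriv
    rw [iteratedDeriv_succ', h.iteratedDeriv_eq,
      iteratedDeriv_add hψ.contDiffAt hd.contDiffAt, ih hψ.deriv, ← iteratedDeriv_succ']
    push_cast
    ring

theorem deriv_eventuallyEq_dslope_add (hf : AnalyticAt 𝕜 f a) :
    deriv f =ᶠ[𝓝 a] fun s => dslope f a s + (s - a) * deriv (dslope f a) s := by
  have hf_eq : f = fun s => f a + (s - a) * dslope f a s := by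
    funext s
    have := sub_smul_dslope f a s
    rw [smul_eq_mul] at this
    rw [this]
    ring
  filter_upwards [hf.dslope_same.eventually_analyticAt] with s hs
  have h : HasDerivAt (fun s => f a + (s - a) * dslope f a s)
      (1 * dslope f a s + (s - a) * deriv (dslope f a) s) s :=
    (((hasDerivAt_id s).sub_const a).mul hs.differentiableAt.hasDerivAt).const_add _
  rw [← hf_eq] at h
  simpa using h.deriv

theorem iteratedDeriv_succ_inv_dslope_pow_mul_deriv (hf : AnalyticAt 𝕜 f a) (hf' : deriv f a ≠ 0)
    (n : ℕ) :
    iteratedDeriv (n + 1) (fun s => (dslope f a s)⁻¹ ^ (n + 2) * deriv f s) a = 0 := by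
  have hψ := hf.dslope_same
  have hψa : dslope f a a ≠ 0 := by rwa [_root_.dslope_same]
  have hφ : AnalyticAt 𝕜 (fun s => (dslope f a s)⁻¹) a := hψ.inv hψa
  have hne : ∀ᶠ s in 𝓝 a, dslope f a s ≠ 0 := hψ.continuousAt.eventually_ne hψa
  have hχ : AnalyticAt 𝕜 (fun s => (dslope f a s)⁻¹ ^ (n + 2) * deriv (dslope f a) s) a :=
    (hφ.pow (n + 2)).mul hψ.deriv
  have hpow : AnalyticAt 𝕜 (fun s => (dslope f a s)⁻¹ ^ (n + 1)) a := hφ.pow (n + 1)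
  have h₁ : (fun s => (dslope f a s)⁻¹ ^ (n + 2) * deriv f s) =ᶠ[𝓝 a]
      (fun s => (dslope f a s)⁻¹ ^ (n + 1)) +
        fun s => (s - a) * ((dslope f a s)⁻¹ ^ (n + 2) * deriv (dslope f a) s) := by
    filter_upwards [deriv_eventuallyEq_dslope_add hf, hne] with s hs hs'
    simp only [hs, Pi.add_apply]
    linear_combination (dslope f a s)⁻¹ ^ (n + 1) * inv_mul_cancel₀ hs'
  have h₂ : deriv (fun s => (dslope f a s)⁻¹ ^ (n + 1)) =ᶠ[𝓝 a]
      fun s => -((n : 𝕜) + 1) * ((dslope f a s)⁻¹ ^ (n + 2) * deriv (dslope f a) s) := by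
    filter_upwards [hψ.eventually_analyticAt, hne] with s hs hs'
    have h := (hs.differentiableAt.hasDerivAt.fun_inv hs').fun_pow (n + 1)
    rw [h.deriv, Nat.add_sub_cancel, div_eq_mul_inv, ← inv_pow]
    push_cast
    ring
  have hmul : AnalyticAt 𝕜
      (fun s => (s - a) * ((dslope f a s)⁻¹ ^ (n + 2) * deriv (dslope f a) s)) a :=
    (analyticAt_id.sub analyticAt_const).mul hχ
  rw [h₁.iteratedDeriv_eq, iteratedDeriv_add hpow.contDiffAt hmul.contDiffAt,
    iteratedDeriv_succ_sub_mul hχ, iteratedDeriv_succ', h₂.iteratedDeriv_eq,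
    iteratedDeriv_const_mul_field]
  ring

/-- Change of variables for residues: the `n`-th Taylor coefficient of `G` at `f a` can be computed
in the variable `s` of `f s`. -/
theorem iteratedDeriv_inv_dslope_pow_mul_comp_mul_deriv (hf : AnalyticAt 𝕜 f a)
    (hf' : deriv f a ≠ 0) {G : 𝕜 → 𝕜} (hG : AnalyticAt 𝕜 G (f a)) (n : ℕ) :
    iteratedDeriv n (fun s => (dslope f a s)⁻¹ ^ (n + 1) * (G (f s) * deriv f s)) a =
      iteratedDeriv n G (f a) := by
  induction n generalizing G with
  | zero => simp [hf', mul_comm (G (f a))]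
  | succ n ih =>
    have hψ := hf.dslope_same
    have hψa : dslope f a a ≠ 0 := by rwa [_root_.dslope_same]
    have hφ : AnalyticAt 𝕜 (fun s => (dslope f a s)⁻¹) a := hψ.inv hψa
    have hne : ∀ᶠ s in 𝓝 a, dslope f a s ≠ 0 := hψ.continuousAt.eventually_ne hψa
    have hH := hG.dslope_same
    have hG_eq : ∀ w, G w = G (f a) + (w - f a) * dslope G (f a) w := fun w => by
      have := sub_smul_dslope G (f a) w
      rw [smul_eq_mul] at this
      rw [this]
      ring
    have hχ : AnalyticAt 𝕜
        (fun s => (dslope f a s)⁻¹ ^ (n + 1) * (dslope G (f a) (f s) * deriv f s)) a :=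
      (hφ.pow (n + 1)).mul ((hH.comp hf).mul hf.deriv)
    have h₁ : (fun s => (dslope f a s)⁻¹ ^ (n + 1 + 1) * (G (f s) * deriv f s)) =ᶠ[𝓝 a]
        (fun s => G (f a) * ((dslope f a s)⁻¹ ^ (n + 2) * deriv f s)) +
          fun s => (s - a) *
            ((dslope f a s)⁻¹ ^ (n + 1) * (dslope G (f a) (f s) * deriv f s)) := by
      filter_upwards [hne] with s hs
      have hfs := sub_smul_dslope f a s
      rw [smul_eq_mul] at hfs
      rw [hG_eq (f s), ← hfs]
      simp only [Pi.add_apply]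
      linear_combination (dslope f a s)⁻¹ ^ (n + 1) * (s - a) * dslope G (f a) (f s) *
        deriv f s * inv_mul_cancel₀ hs
    have h₂ : G = (fun _ => G (f a)) + fun w => (w - f a) * dslope G (f a) w := funext hG_eq
    have hA : AnalyticAt 𝕜 (fun s => G (f a) * ((dslope f a s)⁻¹ ^ (n + 2) * deriv f s)) a :=
      analyticAt_const.mul ((hφ.pow (n + 2)).mul hf.deriv)
    have hB : AnalyticAt 𝕜 (fun s => (s - a) *
        ((dslope f a s)⁻¹ ^ (n + 1) * (dslope G (f a) (f s) * deriv f s))) a :=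
      (analyticAt_id.sub analyticAt_const).mul hχ
    have hC : AnalyticAt 𝕜 (fun w => (w - f a) * dslope G (f a) w) (f a) :=
      (analyticAt_id.sub analyticAt_const).mul hH
    rw [h₁.iteratedDeriv_eq, iteratedDeriv_add hA.contDiffAt hB.contDiffAt,
      iteratedDeriv_const_mul_field, iteratedDeriv_succ_inv_dslope_pow_mul_deriv hf hf',
      iteratedDeriv_succ_sub_mul hχ, ih hH]
    conv_rhs => rw [h₂]
    rw [iteratedDeriv_add contDiffAt_const hC.contDiffAt, iteratedDeriv_succ_sub_mul hH]
    simp [iteratedDeriv_const]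

theorem iteratedDeriv_succ_of_eventually_left_inverse (hf : AnalyticAt 𝕜 f a)
    (hf' : deriv f a ≠ 0) {g : 𝕜 → 𝕜} (hg : AnalyticAt 𝕜 g (f a))
    (hgf : ∀ᶠ s in 𝓝 a, g (f s) = s) (n : ℕ) :
    iteratedDeriv (n + 1) g (f a) =
      iteratedDeriv n (fun s => (dslope f a s)⁻¹ ^ (n + 1)) a := by
  rw [iteratedDeriv_succ', ← iteratedDeriv_inv_dslope_pow_mul_comp_mul_deriv hf hf' hg.deriv n]
  refine Filter.EventuallyEq.iteratedDeriv_eq n ?_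
  filter_upwards [hgf.eventually_nhds, hf.eventually_analyticAt,
    hf.continuousAt.eventually hg.eventually_analyticAt] with s hs hfs hgs
  have h := hgs.differentiableAt.hasDerivAt.comp s hfs.differentiableAt.hasDerivAt
  have h' : HasDerivAt (g ∘ f) 1 s := (hasDerivAt_id s).congr_of_eventuallyEq hs
  rw [h.unique h', mul_one]

theorem tendsto_iteratedDeriv_div_pow (hf : AnalyticAt 𝕜 f a) (hf' : deriv f a ≠ 0) (m n : ℕ) :
    Tendsto (iteratedDeriv m fun s => ((s - a) / (f s - f a)) ^ n) (𝓝[≠] a)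
      (𝓝 (iteratedDeriv m (fun s => (dslope f a s)⁻¹ ^ n) a)) := by
  have hφ : AnalyticAt 𝕜 (fun s => (dslope f a s)⁻¹ ^ n) a :=
    (hf.dslope_same.inv (by rwa [_root_.dslope_same])).pow n
  have hcont : ContinuousAt (iteratedDeriv m fun s => (dslope f a s)⁻¹ ^ n) a := by
    rw [iteratedDeriv_eq_iterate]
    exact (hφ.iterated_deriv m).continuousAt
  refine (hcont.tendsto.mono_left nhdsWithin_le_nhds).congr' ?_
  filter_upwards [self_mem_nhdsWithin] with σ hσ
  refine Filter.EventuallyEq.iteratedDeriv_eq m ?_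
  filter_upwards [isOpen_ne.mem_nhds hσ] with s hs
  rw [dslope_of_ne f hs, slope_def_field, inv_div]

end LagrangeCoefficients

/-- Lagrange inversion theorem: if `f` is real analytic at `σ₀` with `f′(σ₀) ≠ 0`,
and for each `n ≥ 1` the coefficient
`b_n = lim_{σ → σ₀} ∂_σ^{n−1} ((σ−σ₀)/(f(σ)−f(σ₀)))^n` exists, then there is `R > 0`
such that for every `u` with `|u − f(σ₀)| < R` the series
`σ₀ + Σ_{n≥1} (b_n/n!) (u − f(σ₀))^n` converges, its sum `σ` satisfies `f(σ) = u`,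
and the map `u ↦ σ` is real analytic on `(f(σ₀) − R, f(σ₀) + R)`. -/
theorem lagrange_inversion (f : ℝ → ℝ) (σ₀ : ℝ)
    (hf : AnalyticAt ℝ f σ₀) (hf' : deriv f σ₀ ≠ 0)
    (b : ℕ → ℝ)
    (hb : ∀ n : ℕ, 1 ≤ n →
      Tendsto
        (fun σ => iteratedDeriv (n - 1)
          (fun s => ((s - σ₀) / (f s - f σ₀)) ^ n) σ)
        (nhdsWithin σ₀ {σ₀}ᶜ) (nhds (b n))) :
    ∃ R : ℝ, 0 < R ∧
      (∀ u : ℝ, |u - f σ₀| < R →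
        Summable (fun n : ℕ =>
          b (n + 1) / (Nat.factorial (n + 1) : ℝ) * (u - f σ₀) ^ (n + 1)) ∧
        f (σ₀ + ∑' n : ℕ,
          b (n + 1) / (Nat.factorial (n + 1) : ℝ) * (u - f σ₀) ^ (n + 1)) = u) ∧
      AnalyticOn ℝ
        (fun u => σ₀ + ∑' n : ℕ,
          b (n + 1) / (Nat.factorial (n + 1) : ℝ) * (u - f σ₀) ^ (n + 1))
        (Set.Ioo (f σ₀ - R) (f σ₀ + R)) := by
  have hs := hf.hasStrictDerivAt
  set g := hs.localInverse f (deriv f σ₀) σ₀ hf' with hg_def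
  have hg : AnalyticAt ℝ g (f σ₀) := hf.analyticAt_localInverse hf'
  have hgf : ∀ᶠ s in 𝓝 σ₀, g (f s) = s := hs.eventually_left_inverse hf'
  have hfg : ∀ᶠ u in 𝓝 (f σ₀), f (g u) = u := hs.eventually_right_inverse hf'
  have hcoeff : ∀ n, iteratedDeriv (n + 1) g (f σ₀) = b (n + 1) := fun n => by
    rw [iteratedDeriv_succ_of_eventually_left_inverse hf hf' hg hgf]
    exact tendsto_nhds_unique (tendsto_iteratedDeriv_div_pow hf hf' n (n + 1))
      (hb (n + 1) (Nat.le_add_left 1 n))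
  obtain ⟨r, hr⟩ := hg.hasFPowerSeriesAt
  have hball : ∀ᶠ u in 𝓝 (f σ₀), u ∈ Metric.eball (f σ₀) r := Metric.eball_mem_nhds _ hr.r_pos
  obtain ⟨R, hR, hRsub⟩ := Metric.eventually_nhds_iff.1 (hball.and hfg)
  have hsum : ∀ u, |u - f σ₀| < R → HasSum (fun n : ℕ =>
      b (n + 1) / (Nat.factorial (n + 1) : ℝ) * (u - f σ₀) ^ (n + 1)) (g u - σ₀) := fun u hu => by
    have h := hr.hasSum_sub (hRsub (y := u) (by rwa [Real.dist_eq])).1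
    simp only [FormalMultilinearSeries.ofScalars_apply_eq, smul_eq_mul] at h
    rw [← hasSum_nat_add_iff' 1] at h
    simpa [hcoeff, hgf.self_of_nhds] using h
  have heq : ∀ u, |u - f σ₀| < R → σ₀ + ∑' n : ℕ,
      b (n + 1) / (Nat.factorial (n + 1) : ℝ) * (u - f σ₀) ^ (n + 1) = g u := fun u hu => by
    rw [(hsum u hu).tsum_eq]
    ring
  refine ⟨R, hR, fun u hu => ⟨(hsum u hu).summable, ?_⟩, ?_⟩
  · rw [heq u hu]
    exact (hRsub (by rwa [Real.dist_eq])).2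
  · rw [← Real.ball_eq_Ioo]
    refine AnalyticOn.congr (f := g) ?_ fun u hu => heq u (by rwa [← Real.dist_eq])
    exact (hr.analyticOnNhd.mono fun u hu => (hRsub hu).1).analyticOn
end

section
/- Fix t > 0, σ > 0, y, k ∈ ℝ, and fix any λ_i < −1. For λ_r ∈ ℝ write λ = λ_r + i λ_i and let φ(λ) = −(σ²/2)(λ² + iλ). Then the function λ_r ↦ e^{t φ(λ)} · ( −e^{k − ikλ}/(iλ + λ²) ) · e^{iλy} is integrable on ℝ and (1/(2π)) ∫_ℝ e^{t φ(λ_r + iλ_i)} · ( −e^{k − ik(λ_r + iλ_i)}/( i(λ_r + iλ_i) + (λ_r + iλ_i)² ) ) · e^{i(λ_r + iλ_i) y} dλ_r = e^y Φ(d₊) − e^k Φ(d₋), where Φ(x) = ∫_{−∞}^x e^{−u²/2}/√(2π) du is the standard normal cumulative distribution function, d₊ = (y − k + σ²t/2)/(σ√t) and d₋ = d₊ − σ√t. -/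
open MeasureTheory

/-- The Lewis-type integrand for the call price: the generalized Fourier transform of
the call payoff multiplied by the Black–Scholes characteristic function and the
inverse-transform kernel, evaluated along the contour `Im λ = λᵢ`. -/
noncomputable def lewisIntegrand (t σ y k li : ℝ) (lr : ℝ) : ℂ :=
  Complex.exp ((t : ℂ) *
      (-(σ : ℂ) ^ 2 / 2 *
        (((lr : ℂ) + Complex.I * (li : ℂ)) ^ 2 +
          Complex.I * ((lr : ℂ) + Complex.I * (li : ℂ))))) *
    (-Complex.exp ((k : ℂ) - Complex.I * (k : ℂ) * ((lr : ℂ) + Complex.I * (li : ℂ))) /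
      (Complex.I * ((lr : ℂ) + Complex.I * (li : ℂ)) +
        ((lr : ℂ) + Complex.I * (li : ℂ)) ^ 2)) *
    Complex.exp (Complex.I * ((lr : ℂ) + Complex.I * (li : ℂ)) * (y : ℂ))

open Complex in
/-- The Gaussian factor along the vertical line `Re s = c` is integrable. -/
lemma integrable_cexp_sq_vertical (τ c w : ℝ) (hτ : 0 < τ) :
    Integrable (fun r : ℝ => cexp ((τ : ℂ) ^ 2 / 2 * (c + I * r) ^ 2 + w * (c + I * r))) := by
  have hre : (-(τ : ℂ) ^ 2 / 2).re < 0 := by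
    rw [show (-(τ : ℂ) ^ 2 / 2) = ((-τ ^ 2 / 2 : ℝ) : ℂ) by push_cast; ring, ofReal_re]
    nlinarith [pow_pos hτ 2]
  refine (integrable_cexp_quadratic' hre (τ ^ 2 * c * I + w * I)
    (τ ^ 2 / 2 * c ^ 2 + w * c)).congr (Filter.Eventually.of_forall fun r => ?_)
  refine congrArg cexp ?_
  ring_nf
  simp only [I_sq]
  ring

open Complex in
/-- The Gaussian integral along the vertical line `Re s = c` does not depend on `c`. -/
lemma integral_cexp_sq_vertical (τ c x : ℝ) (hτ : 0 < τ) :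
    ∫ r : ℝ, cexp ((τ : ℂ) ^ 2 / 2 * (c + I * r) ^ 2 + x * (c + I * r)) =
      ((Real.sqrt (2 * Real.pi) / τ * Real.exp (-(x / τ) ^ 2 / 2) : ℝ) : ℂ) := by
  have hre : (-(τ : ℂ) ^ 2 / 2).re < 0 := by
    rw [show (-(τ : ℂ) ^ 2 / 2) = ((-τ ^ 2 / 2 : ℝ) : ℂ) by push_cast; ring, ofReal_re]
    nlinarith [pow_pos hτ 2]
  have hτ' : (τ : ℂ) ≠ 0 := by exact_mod_cast hτ.ne'
  have hexp (r : ℝ) : (τ : ℂ) ^ 2 / 2 * (c + I * r) ^ 2 + x * (c + I * r) =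
      -(τ : ℂ) ^ 2 / 2 * r ^ 2 + (τ ^ 2 * c * I + x * I) * r + (τ ^ 2 / 2 * c ^ 2 + x * c) := by
    ring_nf
    simp only [I_sq]
    ring
  simp_rw [hexp]
  rw [integral_cexp_quadratic hre, ofReal_mul, ofReal_exp]
  congr 1
  · rw [show (Real.pi / -(-(τ : ℂ) ^ 2 / 2)) = ((2 * Real.pi / τ ^ 2 : ℝ) : ℂ) by
        push_cast; field_simp,
      show (1 / 2 : ℂ) = ((1 / 2 : ℝ) : ℂ) by push_cast; rfl,
      ← ofReal_cpow (by positivity), ← Real.sqrt_eq_rpow, Real.sqrt_div (by positivity),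
      Real.sqrt_sq hτ.le]
  · congr 1
    push_cast
    field_simp
    ring_nf
    simp only [I_sq]
    ring

/-- Change of variables expressing the normal distribution function with scale `τ`. -/
lemma setIntegral_Iic_gaussian_scale (τ w : ℝ) (hτ : 0 < τ) :
    ∫ x in Set.Iic w, Real.sqrt (2 * Real.pi) / τ * Real.exp (-(x / τ) ^ 2 / 2) =
      2 * Real.pi * stdNormalCdf (w / τ) := by
  have h := Measure.setIntegral_comp_smul_of_pos volume
    (fun u : ℝ => Real.exp (-u ^ 2 / 2) / Real.sqrt (2 * Real.pi)) (Set.Iio w) (inv_pos.2 hτ)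
  rw [LinearOrderedField.smul_Iio (inv_pos.2 hτ)] at h
  simp only [smul_eq_mul, Module.finrank_self, pow_one, inv_inv, inv_mul_eq_div] at h
  have hpi : Real.sqrt (2 * Real.pi) ≠ 0 := by positivity
  have hsq : Real.sqrt (2 * Real.pi) * Real.sqrt (2 * Real.pi) = 2 * Real.pi :=
    Real.mul_self_sqrt (by positivity)
  have hf (x : ℝ) : Real.sqrt (2 * Real.pi) / τ * Real.exp (-(x / τ) ^ 2 / 2) =
      2 * Real.pi / τ * (Real.exp (-(x / τ) ^ 2 / 2) / Real.sqrt (2 * Real.pi)) := by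
    field_simp
    linear_combination hsq
  simp_rw [hf]
  rw [integral_Iic_eq_integral_Iio, integral_const_mul, h, stdNormalCdf]
  field_simp

open Complex in
/-- Dividing the Gaussian factor by `s` on `Re s = c > 0` keeps it integrable. -/
lemma integrable_cexp_sq_vertical_div (τ c w : ℝ) (hτ : 0 < τ) (hc : 0 < c) :
    Integrable (fun r : ℝ =>
      cexp ((τ : ℂ) ^ 2 / 2 * (c + I * r) ^ 2 + w * (c + I * r)) / (c + I * r)) := by
  have hne (r : ℝ) : (c + I * r : ℂ) ≠ 0 := fun h => hc.ne' (by simpa using congrArg re h)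
  refine ((integrable_cexp_sq_vertical τ c w hτ).norm.mul_const c⁻¹).mono' ?_
    (Filter.Eventually.of_forall fun r => ?_)
  · exact (Continuous.div (by fun_prop) (by fun_prop) hne).aestronglyMeasurable
  · rw [norm_div, div_eq_mul_inv]
    gcongr
    simpa [abs_of_pos hc] using abs_re_le_norm (c + I * r : ℂ)

open Complex in
/-- Bromwich-type representation of the normal distribution function. -/
lemma integral_cexp_sq_vertical_div (τ c w : ℝ) (hτ : 0 < τ) (hc : 0 < c) :
    ∫ r : ℝ, cexp ((τ : ℂ) ^ 2 / 2 * (c + I * r) ^ 2 + w * (c + I * r)) / (c + I * r) =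
      ((2 * Real.pi * stdNormalCdf (w / τ) : ℝ) : ℂ) := by
  have hre (r : ℝ) : 0 < (c + I * r : ℂ).re := by simpa using hc
  have hinner (r : ℝ) :
      cexp ((τ : ℂ) ^ 2 / 2 * (c + I * r) ^ 2 + w * (c + I * r)) / (c + I * r) =
        ∫ x in Set.Iic w, cexp ((τ : ℂ) ^ 2 / 2 * (c + I * r) ^ 2 + x * (c + I * r)) := by
    simp_rw [Complex.exp_add]
    rw [integral_const_mul]
    simp_rw [mul_comm _ (c + I * r : ℂ)]
    rw [integral_exp_mul_complex_Iic (hre r), mul_div_assoc]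
  simp_rw [hinner]
  rw [integral_integral_swap]
  · simp_rw [integral_cexp_sq_vertical τ c _ hτ]
    rw [integral_complex_ofReal, setIntegral_Iic_gaussian_scale τ w hτ]
  · have hg := (integrable_cexp_sq_vertical τ c 0 hτ).norm
    have hh : Integrable (fun x : ℝ => Real.exp (c * x)) (volume.restrict (Set.Iic w)) :=
      integrableOn_exp_mul_Iic hc w
    refine (hg.mul_prod hh).mono' ?_ (Filter.Eventually.of_forall fun z => ?_)
    · exact Continuous.aestronglyMeasurable (by unfold Function.uncurry; fun_prop)
    · simp only [Function.uncurry, Complex.exp_add, norm_mul]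
      simp [Complex.norm_exp, mul_comm]

open Complex in
/-- Partial fractions split the Lewis integrand into an asset part and a cash part. -/
lemma lewisIntegrand_eq_sub (t σ y k li : ℝ) (ht : 0 < t) (hli : li < -1) (r : ℝ) :
    lewisIntegrand t σ y k li r =
      Real.exp y * (cexp (((σ * Real.sqrt t : ℝ) : ℂ) ^ 2 / 2 * ((-li - 1 : ℝ) + I * r) ^ 2 +
        (y - k + σ ^ 2 * t / 2 : ℝ) * ((-li - 1 : ℝ) + I * r)) / ((-li - 1 : ℝ) + I * r)) -
      Real.exp k * (cexp (((σ * Real.sqrt t : ℝ) : ℂ) ^ 2 / 2 * ((-li : ℝ) + I * r) ^ 2 +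
        (y - k - σ ^ 2 * t / 2 : ℝ) * ((-li : ℝ) + I * r)) / ((-li : ℝ) + I * r)) := by
  have hτ : ((σ * Real.sqrt t : ℝ) : ℂ) ^ 2 = (σ : ℂ) ^ 2 * t := by
    rw [← ofReal_pow, mul_pow, Real.sq_sqrt ht.le]
    push_cast
    rfl
  rw [hτ, lewisIntegrand]
  obtain ⟨s, hs⟩ : ∃ s : ℂ, s = (-li : ℝ) + I * r := ⟨_, rfl⟩
  have h0 : s ≠ 0 := by
    intro h
    have := congrArg re (hs.symm.trans h)
    simp at this
    linarith
  have h1 : s - 1 ≠ 0 := by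
    intro h
    have := congrArg re h
    simp [hs] at this
    linarith
  have hI : I * ((r : ℂ) + I * li) = s := by
    rw [hs, mul_add, ← mul_assoc, I_mul_I]
    push_cast
    ring
  have hsq : ((r : ℂ) + I * li) ^ 2 = -s ^ 2 := by
    rw [← hI, mul_pow, I_sq]
    ring
  have hk : I * (k : ℂ) * ((r : ℂ) + I * li) = k * s := by
    rw [← hI]
    ring
  have hs1 : ((-li - 1 : ℝ) : ℂ) + I * r = s - 1 := by
    rw [hs]
    push_cast
    ring
  rw [hs1, ← hs, hI, hsq, hk, ofReal_exp, ofReal_exp, ← mul_div_assoc (cexp y),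
    ← mul_div_assoc (cexp k), ← Complex.exp_add (y : ℂ), ← Complex.exp_add (k : ℂ)]
  have hE : cexp ((t : ℂ) * (-(σ : ℂ) ^ 2 / 2 * (-s ^ 2 + s))) * cexp (k - k * s) * cexp (s * y) =
      cexp (y + ((σ : ℂ) ^ 2 * t / 2 * (s - 1) ^ 2 +
        (y - k + σ ^ 2 * t / 2 : ℝ) * (s - 1))) := by
    rw [← Complex.exp_add, ← Complex.exp_add]
    congr 1
    push_cast
    ring
  have hE' : (k : ℂ) + ((σ : ℂ) ^ 2 * t / 2 * s ^ 2 + (y - k - σ ^ 2 * t / 2 : ℝ) * s) =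
      y + ((σ : ℂ) ^ 2 * t / 2 * (s - 1) ^ 2 + (y - k + σ ^ 2 * t / 2 : ℝ) * (s - 1)) := by
    push_cast
    ring
  rw [hE', ← hE, show s + -s ^ 2 = -(s * (s - 1)) by ring, neg_div_neg_eq]
  field_simp
  ring

/-- Lewis-type generalized Fourier representation of the Black–Scholes call price:
for any contour `Im λ = λᵢ < −1`, the integrand is integrable and
`(1/2π) ∫_ℝ e^{tφ(λ)} (−e^{k−ikλ}/(iλ+λ²)) e^{iλy} dλ_r = e^y Φ(d₊) − e^k Φ(d₋)`,
where `φ(λ) = −(σ²/2)(λ² + iλ)`, `d₊ = (y − k + σ²t/2)/(σ√t)` and `d₋ = d₊ − σ√t`. -/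
theorem lewis_formula_black_scholes (t σ y k li : ℝ) (ht : 0 < t) (hσ : 0 < σ)
    (hli : li < -1) :
    Integrable (fun lr : ℝ => lewisIntegrand t σ y k li lr) volume ∧
    (1 / (2 * Real.pi) : ℂ) * (∫ lr : ℝ, lewisIntegrand t σ y k li lr) =
      ((Real.exp y * stdNormalCdf ((y - k + σ ^ 2 * t / 2) / (σ * Real.sqrt t)) -
          Real.exp k * stdNormalCdf ((y - k + σ ^ 2 * t / 2) / (σ * Real.sqrt t) -
            σ * Real.sqrt t) : ℝ) : ℂ) := by
  have hτ : 0 < σ * Real.sqrt t := by positivity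
  have hd : (y - k + σ ^ 2 * t / 2) / (σ * Real.sqrt t) - σ * Real.sqrt t =
      (y - k - σ ^ 2 * t / 2) / (σ * Real.sqrt t) := by
    rw [sub_eq_iff_eq_add, div_add' _ _ _ hτ.ne', mul_mul_mul_comm, Real.mul_self_sqrt ht.le]
    ring
  have hasset := (integrable_cexp_sq_vertical_div (σ * Real.sqrt t) (-li - 1)
    (y - k + σ ^ 2 * t / 2) hτ (by linarith)).const_mul (Real.exp y : ℂ)
  have hcash := (integrable_cexp_sq_vertical_div (σ * Real.sqrt t) (-li)
    (y - k - σ ^ 2 * t / 2) hτ (by linarith)).const_mul (Real.exp k : ℂ)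
  simp_rw [lewisIntegrand_eq_sub t σ y k li ht hli]
  refine ⟨hasset.sub hcash, ?_⟩
  rw [integral_sub hasset hcash, integral_const_mul, integral_const_mul,
    integral_cexp_sq_vertical_div _ _ _ hτ (by linarith),
    integral_cexp_sq_vertical_div _ _ _ hτ (by linarith), hd]
  have hpi : (Real.pi : ℂ) ≠ 0 := by exact_mod_cast Real.pi_ne_zero
  push_cast
  field_simp
end
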